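/- For all continuous functions g, g′ : [0,∞) → [0,∞) with compact support and g(0) = g′(0) = 0, the rooted compact real trees T_g and T_{g′} coded by g and g′ satisfy d_GH(T_g, T_{g′}) ≤ 2·sup_{t≥0} |g(t) − g′(t)|, where d_GH denotes the rooted Gromov–Hausdorff distance. -/

import Mathlib

open scoped NNReal

noncomputable section

/-- The pseudo-distance `d_g (s,t) = g s + g t - 2 inf_{u ∈ [s ∧ t, s ∨ t]} g u`
associated to a coding function `g : [0,∞) → [0,∞)`. -/
def treeDist (g : ℝ≥0 → ℝ) (s t : ℝ≥0) : ℝ :=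
  g s + g t - 2 * sInf (g '' Set.Icc (min s t) (max s t))

/-- The rooted Gromov–Hausdorff distance between two pointed metric spaces:
the infimum over all isometric embeddings `φ : X → E`, `ψ : Y → E` into a common
metric space `E` of `max (Hausdorff distance of the images) (dist (φ x) (ψ y))`. -/
def rootedGHDist (X Y : Type) [MetricSpace X] [MetricSpace Y] (x : X) (y : Y) : ℝ :=
  sInf {r : ℝ | ∃ (E : Type) (_ : MetricSpace E) (φ : X → E) (ψ : Y → E),
    Isometry φ ∧ Isometry ψ ∧
      max (Metric.hausdorffDist (Set.range φ) (Set.range ψ)) (dist (φ x) (ψ y)) = r}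

/-- Two pointed spaces admitting a surjective parametrization by a common set which distorts
distances by at most `2 * ε` are at rooted Gromov–Hausdorff distance at most `ε`. -/
theorem rootedGHDist_le_of_abs_dist_sub_le {X Y Z : Type} [MetricSpace X] [MetricSpace Y]
    {Φ : Z → X} {Ψ : Z → Y} (hΦ : Function.Surjective Φ) (hΨ : Function.Surjective Ψ)
    {ε : ℝ} (hε : 0 < ε) (H : ∀ p q, |dist (Φ p) (Φ q) - dist (Ψ p) (Ψ q)| ≤ 2 * ε) (z : Z) :
    rootedGHDist X Y (Φ z) (Ψ z) ≤ ε := by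
  have : Nonempty Z := ⟨z⟩
  let : MetricSpace (X ⊕ Y) := Metric.glueMetricApprox Φ Ψ ε hε H
  have hdist : ∀ p, dist (Sum.inl (Φ p) : X ⊕ Y) (Sum.inr (Ψ p)) = ε :=
    Metric.glueDist_glued_points Φ Ψ ε
  have hHaus : Metric.hausdorffDist (Set.range (Sum.inl : X → X ⊕ Y)) (Set.range Sum.inr) ≤ ε := by
    refine Metric.hausdorffDist_le_of_mem_dist hε.le ?_ ?_
    · rintro _ ⟨x, rfl⟩
      obtain ⟨p, rfl⟩ := hΦ x
      exact ⟨_, ⟨Ψ p, rfl⟩, (hdist p).le⟩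
    · rintro _ ⟨y, rfl⟩
      obtain ⟨p, rfl⟩ := hΨ y
      exact ⟨_, ⟨Φ p, rfl⟩, (dist_comm _ _).trans_le (hdist p).le⟩
  refine le_trans (csInf_le ⟨0, ?_⟩ ⟨X ⊕ Y, inferInstance, Sum.inl, Sum.inr,
    Isometry.of_dist_eq fun _ _ => rfl, Isometry.of_dist_eq fun _ _ => rfl, rfl⟩)
    (max_le hHaus (hdist z).le)
  rintro _ ⟨E, _, φ, ψ, -, -, rfl⟩
  exact le_max_of_le_right dist_nonneg

theorem sInf_image_le_add {α : Type*} {g g' : α → ℝ} {δ : ℝ} (h : ∀ t, |g t - g' t| ≤ δ)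
    (hpos : ∀ t, 0 ≤ g t) {s : Set α} (hs : s.Nonempty) :
    sInf (g '' s) ≤ sInf (g' '' s) + δ := by
  rw [← sub_le_iff_le_add]
  refine le_csInf (hs.image _) ?_
  rintro _ ⟨t, ht, rfl⟩
  have hle : sInf (g '' s) ≤ g t :=
    csInf_le ⟨0, by rintro _ ⟨u, -, rfl⟩; exact hpos u⟩ ⟨t, ht, rfl⟩
  linarith [(abs_le.1 (h t)).2]

theorem abs_treeDist_sub_le {g g' : ℝ≥0 → ℝ} {δ : ℝ} (h : ∀ t, |g t - g' t| ≤ δ)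
    (hgpos : ∀ t, 0 ≤ g t) (hg'pos : ∀ t, 0 ≤ g' t) (s t : ℝ≥0) :
    |treeDist g s t - treeDist g' s t| ≤ 4 * δ := by
  have hne : (Set.Icc (min s t) (max s t)).Nonempty := Set.nonempty_Icc.2 min_le_max
  have h₁ := sInf_image_le_add h hgpos hne
  have h₂ := sInf_image_le_add (fun u => (abs_sub_comm _ _).trans_le (h u)) hg'pos hne
  have hs := abs_le.1 (h s)
  have ht := abs_le.1 (h t)
  unfold treeDist
  exact abs_le.2 ⟨by linarith, by linarith⟩

/-- for coding functions `g, g'`, the rooted compact real trees `T_g` and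
`T_{g'}` (any metric spaces `T, T'` with surjections `p, p'` inducing the distances
`d_g, d_{g'}`, rooted at the classes `p 0`, `p' 0` of `0`) satisfy
`d_GH(T_g, T_{g'}) ≤ 2 ⬝ sup_{t ≥ 0} |g t - g' t|`. -/
theorem rootedGHDist_le_two_mul_sup (g g' : ℝ≥0 → ℝ)
    (hg : Continuous g) (hg' : Continuous g')
    (hsg : HasCompactSupport g) (hsg' : HasCompactSupport g')
    (hg0 : g 0 = 0) (hg'0 : g' 0 = 0)
    (hgpos : ∀ t, 0 ≤ g t) (hg'pos : ∀ t, 0 ≤ g' t)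
    (T T' : Type) [MetricSpace T] [MetricSpace T']
    (p : ℝ≥0 → T) (p' : ℝ≥0 → T')
    (hp : Function.Surjective p) (hp' : Function.Surjective p')
    (hd : ∀ s t, dist (p s) (p t) = treeDist g s t)
    (hd' : ∀ s t, dist (p' s) (p' t) = treeDist g' s t) :
    rootedGHDist T T' (p 0) (p' 0) ≤ 2 * ⨆ t, |g t - g' t| := by
  obtain ⟨C, hC⟩ := hsg.exists_bound_of_continuous hg
  obtain ⟨C', hC'⟩ := hsg'.exists_bound_of_continuous hg'
  have hbdd : BddAbove (Set.range fun t => |g t - g' t|) := by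
    refine ⟨C + C', ?_⟩
    rintro _ ⟨t, rfl⟩
    exact (norm_sub_le _ _).trans (add_le_add (hC t) (hC' t))
  have hle : ∀ t, |g t - g' t| ≤ ⨆ t, |g t - g' t| := le_ciSup hbdd
  have hnonneg : 0 ≤ ⨆ t, |g t - g' t| := (abs_nonneg _).trans (hle 0)
  refine le_of_forall_pos_le_add fun η hη => ?_
  refine rootedGHDist_le_of_abs_dist_sub_le hp hp' (by linarith) (fun s t => ?_) 0
  rw [hd, hd']
  linarith [abs_treeDist_sub_le hle hgpos hg'pos s t]
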